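/- arXiv:2604.22807 — 2 statements merged into one kernel-verified Lean document; each statement's English description precedes it below -/
import Mathlib

section
/- Let n ≥ 1, T > 0, and let σ denote the uniform probability measure on the unit sphere S^{n−1} = {θ ∈ ℝⁿ : ‖θ‖ = 1} (normalized rotation-invariant surface measure). Let Σ_f be a symmetric positive definite n×n real matrix. Suppose Σ : [0, T] → (n×n real matrices) is continuous on [0, T], symmetric positive definite at every t ∈ [0, T], differentiable on [0, T), and satisfies for every t ∈ [0, T) the matrix ODE Σ′(t) = K(t) Σ(t) + Σ(t) K(t)ᵀ, where K(t) := (1/(T − t)) [ ∫_{S^{n−1}} sqrt((θᵀ Σ_f θ)/(θᵀ Σ(t) θ)) θ θᵀ σ(dθ) − (1/n) I_n ]. Then lim_{t ↗ T} Σ(t) = Σ_f; equivalently, Σ(T) = Σ_f. -/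
open MeasureTheory Metric Matrix

/-- The uniform (normalized rotation-invariant) probability measure on the unit sphere
`S^{n-1} ⊆ ℝⁿ`. -/
noncomputable def sphereUniform (n : ℕ) :
    Measure (sphere (0 : EuclideanSpace ℝ (Fin n)) 1) :=
  ((volume : Measure (EuclideanSpace ℝ (Fin n))).toSphere Set.univ)⁻¹ •
    (volume : Measure (EuclideanSpace ℝ (Fin n))).toSphere

/-- The quadratic form `θᵀ A θ` for a direction `θ` on the unit sphere. -/
noncomputable def squad {n : ℕ} (A : Matrix (Fin n) (Fin n) ℝ)
    (θ : sphere (0 : EuclideanSpace ℝ (Fin n)) 1) : ℝ :=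
  ∑ i, ∑ j, (θ : EuclideanSpace ℝ (Fin n)) i * A i j * (θ : EuclideanSpace ℝ (Fin n)) j
instance sphereUniform_finite (n : ℕ) : IsFiniteMeasure (sphereUniform n) := by
  refine ⟨?_⟩
  unfold sphereUniform
  rw [Measure.smul_apply, smul_eq_mul]
  by_cases h : (volume : Measure (EuclideanSpace ℝ (Fin n))).toSphere Set.univ = 0
  · rw [h]; simp
  · exact ENNReal.mul_lt_top (ENNReal.inv_lt_top.2 (pos_iff_ne_zero.2 h)) (measure_lt_top _ _)

lemma sphereUniform_univ (n : ℕ) (hn : 1 ≤ n) : sphereUniform n Set.univ = 1 := by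
  unfold sphereUniform
  rw [Measure.smul_apply, smul_eq_mul]
  have : Nonempty (Fin n) := ⟨⟨0, hn⟩⟩
  refine ENNReal.inv_mul_cancel ?_ (measure_ne_top _ _)
  rw [Ne, Measure.measure_univ_eq_zero]
  exact Measure.toSphere_ne_zero _

instance sphereUniform_pos (n : ℕ) : (sphereUniform n).IsOpenPosMeasure := by
  refine ⟨fun U hU hne => ?_⟩
  unfold sphereUniform
  rw [Measure.smul_apply, smul_eq_mul]
  exact mul_ne_zero (ENNReal.inv_ne_zero.2 (measure_ne_top _ _)) (hU.measure_ne_zero _ hne)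

/-- action of an isometry on the sphere -/
noncomputable def sphAct {n : ℕ} (e : EuclideanSpace ℝ (Fin n) ≃ₗᵢ[ℝ] EuclideanSpace ℝ (Fin n))
    (θ : sphere (0 : EuclideanSpace ℝ (Fin n)) 1) : sphere (0 : EuclideanSpace ℝ (Fin n)) 1 :=
  ⟨e θ, by simp⟩

lemma sphAct_cont {n : ℕ} (e : EuclideanSpace ℝ (Fin n) ≃ₗᵢ[ℝ] EuclideanSpace ℝ (Fin n)) :
    Continuous (sphAct e) := by
  unfold sphAct
  exact Continuous.subtype_mk (e.continuous.comp continuous_subtype_val) _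

open scoped Pointwise in
lemma toSphere_map {n : ℕ} (e : EuclideanSpace ℝ (Fin n) ≃ₗᵢ[ℝ] EuclideanSpace ℝ (Fin n)) :
    (sphereUniform n).map (sphAct e) = sphereUniform n := by
  unfold sphereUniform
  rw [Measure.map_smul]
  congr 1
  ext s hs
  rw [Measure.map_apply (sphAct_cont e).measurable hs,
    Measure.toSphere_apply' _ ((sphAct_cont e).measurable hs), Measure.toSphere_apply' _ hs]
  congr 1
  rw [← (show MeasurePreserving e.toMeasurableEquiv volume volume from
    e.measurePreserving).measure_preimage_equiv 
      (Set.Ioo (0 : ℝ) 1 • (Set.image Subtype.val s))]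
  congr 1
  ext x
  simp only [Set.mem_smul, Set.mem_image, Set.mem_preimage]
  constructor
  · rintro ⟨r, hr, _, ⟨θ, hθ, rfl⟩, rfl⟩
    exact ⟨r, hr, _, ⟨sphAct e θ, hθ, rfl⟩, by simp [sphAct]⟩
  · rintro ⟨r, hr, _, ⟨θ, hθ, rfl⟩, h⟩
    refine ⟨r, hr, _, ⟨sphAct e.symm θ, ?_, rfl⟩, ?_⟩
    · simpa [sphAct] using hθ
    · apply e.injective
      simpa [sphAct] using h

lemma integral_sphAct {n : ℕ} (e : EuclideanSpace ℝ (Fin n) ≃ₗᵢ[ℝ] EuclideanSpace ℝ (Fin n))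
    (f : sphere (0 : EuclideanSpace ℝ (Fin n)) 1 → ℝ) (hf : Continuous f) :
    ∫ θ, f (sphAct e θ) ∂(sphereUniform n) = ∫ θ, f θ ∂(sphereUniform n) := by
  conv_rhs => rw [← toSphere_map e]
  rw [integral_map (sphAct_cont e).aemeasurable hf.aestronglyMeasurable]

lemma integrable_cont {n : ℕ} (f : sphere (0 : EuclideanSpace ℝ (Fin n)) 1 → ℝ)
    (hf : Continuous f) : Integrable f (sphereUniform n) :=
  hf.integrable_of_hasCompactSupport (HasCompactSupport.of_compactSpace f)

lemma coord_cont {n : ℕ} (i : Fin n) :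
    Continuous (fun θ : sphere (0 : EuclideanSpace ℝ (Fin n)) 1 =>
      (θ : EuclideanSpace ℝ (Fin n)) i) := by
  fun_prop

lemma moment_off {n : ℕ} (i j : Fin n) (hij : i ≠ j) :
    ∫ θ : sphere (0 : EuclideanSpace ℝ (Fin n)) 1, ((θ : EuclideanSpace ℝ (Fin n)) i *
      (θ : EuclideanSpace ℝ (Fin n)) j) ∂(sphereUniform n) = 0 := by
  have h := integral_sphAct (LinearIsometryEquiv.piLpCongrRight 2
      (fun k : Fin n => if k = i then LinearIsometryEquiv.neg ℝ else LinearIsometryEquiv.refl ℝ ℝ))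
    (fun θ => (θ : EuclideanSpace ℝ (Fin n)) i * (θ : EuclideanSpace ℝ (Fin n)) j)
    ((coord_cont i).mul (coord_cont j))
  simp [sphAct, hij.symm, integral_neg] at h
  linarith

lemma moment_diag_eq {n : ℕ} (i j : Fin n) :
    ∫ θ : sphere (0 : EuclideanSpace ℝ (Fin n)) 1, ((θ : EuclideanSpace ℝ (Fin n)) i *
      (θ : EuclideanSpace ℝ (Fin n)) i) ∂(sphereUniform n) = 
    ∫ θ : sphere (0 : EuclideanSpace ℝ (Fin n)) 1, ((θ : EuclideanSpace ℝ (Fin n)) j *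
      (θ : EuclideanSpace ℝ (Fin n)) j) ∂(sphereUniform n) := by
  have h := integral_sphAct (LinearIsometryEquiv.piLpCongrLeft 2 ℝ ℝ (Equiv.swap i j))
    (fun θ => (θ : EuclideanSpace ℝ (Fin n)) i * (θ : EuclideanSpace ℝ (Fin n)) i)
    ((coord_cont i).mul (coord_cont i))
  rw [← h]
  simp [sphAct, LinearIsometryEquiv.piLpCongrLeft_apply, Equiv.piCongrLeft'_apply]

lemma moment {n : ℕ} (hn : 1 ≤ n) (i j : Fin n) :
    ∫ θ : sphere (0 : EuclideanSpace ℝ (Fin n)) 1, ((θ : EuclideanSpace ℝ (Fin n)) i *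
      (θ : EuclideanSpace ℝ (Fin n)) j) ∂(sphereUniform n) = 
      (1 / (n : ℝ)) * (if i = j then 1 else 0) := by
  split_ifs with hij
  · subst hij
    have h1 : ∑ k, ∫ θ : sphere (0 : EuclideanSpace ℝ (Fin n)) 1,
        ((θ : EuclideanSpace ℝ (Fin n)) k * (θ : EuclideanSpace ℝ (Fin n)) k)
          ∂(sphereUniform n) = 1 := by
      rw [← integral_finsetSum _ (fun k _ => integrable_cont
        (fun θ : sphere (0 : EuclideanSpace ℝ (Fin n)) 1 => (θ : EuclideanSpace ℝ (Fin n)) k *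
          (θ : EuclideanSpace ℝ (Fin n)) k) ((coord_cont k).mul (coord_cont k)))]
      have : ∀ θ : sphere (0 : EuclideanSpace ℝ (Fin n)) 1,
        ∑ k, ((θ : EuclideanSpace ℝ (Fin n)) k * (θ : EuclideanSpace ℝ (Fin n)) k) = 1 := by
        intro θ
        have h := EuclideanSpace.real_norm_sq_eq (θ : EuclideanSpace ℝ (Fin n))
        rw [norm_eq_of_mem_sphere] at h
        simp only [← sq]
        linarith
      simp [this, Measure.real, sphereUniform_univ n hn]
    rw [Finset.sum_congr rfl (fun k _ => moment_diag_eq k i)] at h1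
    simp at h1
    have : (n : ℝ) ≠ 0 := by positivity
    rw [mul_one, eq_div_iff this, mul_comm]
    exact h1
  · rw [moment_off i j hij]; simp

lemma squad_eq {n : ℕ} (A : Matrix (Fin n) (Fin n) ℝ)
    (θ : sphere (0 : EuclideanSpace ℝ (Fin n)) 1) :
    squad A θ = (fun i => (θ : EuclideanSpace ℝ (Fin n)) i) ⬝ᵥ
      (A *ᵥ (fun i => (θ : EuclideanSpace ℝ (Fin n)) i)) := by
  simp [squad, dotProduct, mulVec, Finset.mul_sum, mul_assoc]

lemma squad_pos {n : ℕ} (A : Matrix (Fin n) (Fin n) ℝ) (hA : A.PosDef)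
    (θ : sphere (0 : EuclideanSpace ℝ (Fin n)) 1) : 0 < squad A θ := by
  rw [squad_eq]
  have := hA.dotProduct_mulVec_pos (x := fun i => (θ : EuclideanSpace ℝ (Fin n)) i) ?_
  · simpa using this
  · intro h
    have h0 : (θ : EuclideanSpace ℝ (Fin n)) = 0 := by
      ext i; exact congrFun h i
    have := norm_eq_of_mem_sphere θ
    rw [h0] at this; simp at this

lemma squad_cont {n : ℕ} (A : Matrix (Fin n) (Fin n) ℝ) : Continuous (squad A) := by
  unfold squad; fun_prop

lemma mat_eq_zero_of_squad {n : ℕ} (A : Matrix (Fin n) (Fin n) ℝ) (hA : A.IsSymm)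
    (h : ∀ θ, squad A θ = 0) : A = 0 := by
  have hv : ∀ v : EuclideanSpace ℝ (Fin n), (fun i => v i) ⬝ᵥ (A *ᵥ (fun i => v i)) = 0 := by
    intro v
    by_cases hv : v = 0
    · subst hv; simp [dotProduct]
    · have hn : ‖v‖ ≠ 0 := norm_ne_zero_iff.2 hv
      have := h ⟨‖v‖⁻¹ • v, by simp [norm_smul, hn]⟩
      rw [squad_eq] at this
      have h2 : (fun i => (‖v‖⁻¹ • v : EuclideanSpace ℝ (Fin n)) i) = ‖v‖⁻¹ • (fun i => v i) := by
        ext i; simp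
      rw [h2, mulVec_smul, dotProduct_smul, smul_dotProduct] at this
      simpa [hn] using this
  have hw : ∀ v : Fin n → ℝ, v ⬝ᵥ (A *ᵥ v) = 0 := fun v => hv (WithLp.toLp 2 v)
  ext i j
  have h1 := hw (Pi.single i 1 + Pi.single j 1)
  have h2 := hw (Pi.single i 1)
  have h3 := hw (Pi.single j 1)
  have h4 : A j i = A i j := hA.apply i j
  simp [mulVec_add, add_dotProduct] at h1 h2 h3
  simp only [Matrix.zero_apply]
  linarith

lemma lyap {n : ℕ} (F S : Matrix (Fin n) (Fin n) ℝ) (hS : S.PosDef) (hF : Fᵀ = F)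
    (h : F * S + S * Fᵀ = 0) : F = 0 := by
  rw [hF] at h
  have hP : (Fᴴ * S * F).PosSemidef := hS.posSemidef.conjTranspose_mul_mul_same F
  have htr : (Fᴴ * S * F).trace = 0 := by
    have h1 : (F * (F * S + S * F)).trace = 0 := by rw [h]; simp
    rw [mul_add, trace_add, trace_mul_comm F (F * S), ← mul_assoc] at h1
    rw [conjTranspose_eq_transpose_of_trivial, hF]
    linarith
  have h0 := hP.trace_eq_zero_iff.1 htr
  have : ∀ x : Fin n → ℝ, F *ᵥ x = 0 := by
    intro x
    by_contra hx
    have h1 := hS.dotProduct_mulVec_pos hx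
    have h2 : x ⬝ᵥ ((Fᴴ * S * F) *ᵥ x) = 0 := by rw [h0]; simp
    rw [star_trivial] at h1
    rw [conjTranspose_eq_transpose_of_trivial, mul_assoc, ← mulVec_mulVec, ← mulVec_mulVec,
      dotProduct_mulVec, vecMul_transpose] at h2
    linarith
  ext i j
  have := congrFun (this (Pi.single j 1)) i
  simpa using this

lemma log_blowup (T : ℝ) (hT : 0 < T) (f G : ℝ → ℝ) (hf : ContinuousOn f (Set.Icc 0 T))
    (hG : ContinuousWithinAt G (Set.Icc 0 T) T)
    (hd : ∀ t ∈ Set.Ico (0 : ℝ) T, HasDerivWithinAt f (1 / (T - t) * G t) (Set.Ico 0 T) t) :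
    G T ≤ 0 := by
  by_contra! hpos
  set c := G T / 2 with hc
  have hcpos : 0 < c := by positivity
  have hev : ∀ᶠ t in nhdsWithin T (Set.Icc 0 T), c < G t :=
    hG.eventually (lt_mem_nhds (by linarith))
  obtain ⟨δ, hδ, hball⟩ := Metric.mem_nhdsWithin_iff.1 hev
  obtain ⟨t0, ht0, ht0T, ht0δ⟩ : ∃ t0, 0 < t0 ∧ t0 < T ∧ T - t0 < δ := by
    refine ⟨T - min (T/2) (δ/2), ?_, ?_, ?_⟩
    · have := min_le_left (T/2) (δ/2); linarith
    · have : 0 < min (T/2) (δ/2) := by positivity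
      linarith
    · have := min_le_right (T/2) (δ/2); linarith
  have hGc : ∀ t, t0 ≤ t → t < T → c < G t := by
    intro t h1 h2
    refine hball ⟨?_, by linarith, h2.le⟩
    rw [Metric.mem_ball, Real.dist_eq, abs_lt]; constructor <;> linarith
  have hmono : MonotoneOn (fun t => f t + c * Real.log (T - t)) (Set.Ico t0 T) := by
    have hder : ∀ t ∈ Set.Ioo t0 T, HasDerivAt (fun t => f t + c * Real.log (T - t))
        (1 / (T - t) * G t + c * (-1 / (T - t))) t := by
      intro t ht
      have h1 : HasDerivAt f (1 / (T - t) * G t) t :=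
        (hd t ⟨by linarith [ht.1], ht.2⟩).hasDerivAt (Ico_mem_nhds (by linarith [ht.1]) ht.2)
      have h2 : HasDerivAt (fun t => T - t) (-1) t := by
        simpa using (hasDerivAt_id t).const_sub T
      exact h1.add ((h2.log (by linarith [ht.2])).const_mul c)
    refine monotoneOn_of_deriv_nonneg (convex_Ico _ _) ?_ ?_ ?_
    · refine (hf.mono fun t ht => ⟨by linarith [ht.1], ht.2.le⟩).add (continuousOn_const.mul ?_)
      refine ContinuousOn.log (by fun_prop) ?_
      intro t ht; linarith [ht.2]
    · rw [interior_Ico]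
      intro t ht
      exact (hder t ht).differentiableAt.differentiableWithinAt
    · rw [interior_Ico]
      intro t ht
      rw [(hder t ht).deriv]
      have h1 := hGc t ht.1.le ht.2
      have h2 : 0 < T - t := by linarith [ht.2]
      have : 1 / (T - t) * G t + c * (-1 / (T - t)) = (G t - c) / (T - t) := by ring
      rw [this]
      exact div_nonneg (by linarith) h2.le
  obtain ⟨M, hM⟩ := (isCompact_Icc.bddAbove_image hf)
  set C := f t0 + c * Real.log (T - t0) with hC
  have hbound : ∀ t ∈ Set.Ico t0 T, (C - M) / c ≤ Real.log (T - t) := by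
    intro t ht
    have h1 := hmono ⟨le_rfl, ht0T⟩ ht ht.1
    have h2 : f t ≤ M := hM ⟨t, ⟨by linarith [ht.1], ht.2.le⟩, rfl⟩
    simp only at h1
    rw [div_le_iff₀ hcpos]; linarith
  set r := min (T - t0) (Real.exp ((C - M) / c - 1)) with hr
  have hr0 : 0 < r := lt_min (by linarith) (Real.exp_pos _)
  have := hbound (T - r) ⟨by have := min_le_left (T - t0) (Real.exp ((C - M) / c - 1)); linarith,
    by linarith⟩
  have h3 : Real.log r ≤ (C - M) / c - 1 := by
    rw [Real.log_le_iff_le_exp hr0]; exact min_le_right _ _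
  rw [sub_sub_cancel] at this
  linarith

lemma int_cont {n : ℕ} (A B : Matrix (Fin n) (Fin n) ℝ) (hB : B.PosDef) :
    Continuous (fun θ => Real.sqrt (squad A θ / squad B θ)) :=
  Real.continuous_sqrt.comp ((squad_cont A).div (squad_cont B) fun θ => (squad_pos B hB θ).ne')

lemma integral_squad {n : ℕ} (A : Matrix (Fin n) (Fin n) ℝ)
    (g : sphere (0 : EuclideanSpace ℝ (Fin n)) 1 → ℝ) (hg : Continuous g) :
    ∫ θ, g θ * squad A θ ∂(sphereUniform n) = ∑ i, ∑ j, A i j *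
      ∫ θ : sphere (0 : EuclideanSpace ℝ (Fin n)) 1, g θ * ((θ : EuclideanSpace ℝ (Fin n)) i *
      (θ : EuclideanSpace ℝ (Fin n)) j) ∂(sphereUniform n) := by
  have : ∀ θ, g θ * squad A θ = ∑ i, ∑ j, A i j * (g θ * ((θ : EuclideanSpace ℝ (Fin n)) i *
      (θ : EuclideanSpace ℝ (Fin n)) j)) := by
    intro θ
    simp only [squad, Finset.mul_sum]
    refine Finset.sum_congr rfl fun i _ => Finset.sum_congr rfl fun j _ => by ring
  simp only [this]
  rw [integral_finsetSum]
  · refine Finset.sum_congr rfl fun i _ => ?_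
    rw [integral_finsetSum]
    · refine Finset.sum_congr rfl fun j _ => ?_
      rw [integral_const_mul]
    · intro j _
      exact integrable_cont _ (by fun_prop)
  · intro i _
    exact integrable_cont _ (by fun_prop)

lemma final_step {n : ℕ} (hn : 1 ≤ n) (S Sf : Matrix (Fin n) (Fin n) ℝ) (hS : S.PosDef)
    (hSf : Sf.PosDef)
    (h : ∀ i j : Fin n, (∫ θ : sphere (0 : EuclideanSpace ℝ (Fin n)) 1,
            Real.sqrt (squad Sf θ / squad S θ) *
              ((θ : EuclideanSpace ℝ (Fin n)) i * (θ : EuclideanSpace ℝ (Fin n)) j)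
            ∂(sphereUniform n)) = (1 / (n : ℝ)) * (if i = j then 1 else 0)) : S = Sf := by
  have hsub : ∀ θ, squad (Sf - S) θ = squad Sf θ - squad S θ := by
    intro θ; simp [squad_eq, sub_mulVec, dotProduct_sub]
  have hg := int_cont Sf S hS
  have h1 := integral_squad (Sf - S) _ hg
  have h2 := integral_squad (Sf - S) (fun _ => 1) continuous_const
  simp only [h] at h1
  simp only [one_mul, moment hn] at h2
  have hc1 : Continuous (fun θ => Real.sqrt (squad Sf θ / squad S θ) * squad (Sf - S) θ) :=
    hg.mul (squad_cont (Sf - S))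
  have h0 : ∫ θ, (Real.sqrt (squad Sf θ / squad S θ) * squad (Sf - S) θ - squad (Sf - S) θ)
      ∂(sphereUniform n) = 0 := by
    rw [integral_sub (integrable_cont _ hc1) (integrable_cont _ (squad_cont _)), h1, h2, sub_self]
  have hfac : ∀ θ, Real.sqrt (squad Sf θ / squad S θ) * squad (Sf - S) θ - squad (Sf - S) θ =
      (Real.sqrt (squad Sf θ / squad S θ) - 1) ^ 2 * (Real.sqrt (squad Sf θ / squad S θ) + 1)
        * squad S θ := by
    intro θ
    have p := squad_pos S hS θ
    have q := squad_pos Sf hSf θ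
    have hs : Real.sqrt (squad Sf θ / squad S θ) ^ 2 = squad Sf θ / squad S θ :=
      Real.sq_sqrt (by positivity)
    have hs' : squad Sf θ = Real.sqrt (squad Sf θ / squad S θ) ^ 2 * squad S θ := by
      rw [hs]; field_simp
    rw [hsub]
    set r := Real.sqrt (squad Sf θ / squad S θ)
    rw [hs']; ring
  have hnn : (0 : sphere (0 : EuclideanSpace ℝ (Fin n)) 1 → ℝ) ≤ fun θ =>
      (Real.sqrt (squad Sf θ / squad S θ) * squad (Sf - S) θ - squad (Sf - S) θ) := by
    intro θ
    have p := squad_pos S hS θ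
    simp only [hfac, Pi.zero_apply]
    positivity
  have hz := (integral_eq_zero_iff_of_nonneg hnn
    (integrable_cont _ (hc1.sub (squad_cont (Sf - S))))).1 h0
  have hz' := (Continuous.ae_eq_iff_eq (sphereUniform n) (hc1.sub (squad_cont (Sf - S)))
    continuous_const).1 hz
  have hq : ∀ θ, squad (Sf - S) θ = 0 := by
    intro θ
    have p := squad_pos S hS θ
    have e := congrFun hz' θ
    have e1 : (Real.sqrt (squad Sf θ / squad S θ) - 1) ^ 2 *
      (Real.sqrt (squad Sf θ / squad S θ) + 1) * squad S θ = 0 := by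
      rw [← hfac]; exact e
    have hr := Real.sqrt_nonneg (squad Sf θ / squad S θ)
    rw [mul_eq_zero, mul_eq_zero] at e1
    have e2 : Real.sqrt (squad Sf θ / squad S θ) = 1 := by
      rcases e1 with (e1 | e1) | e1
      · have := pow_eq_zero_iff (two_ne_zero) |>.1 e1
        linarith
      · linarith
      · linarith
    rw [Real.sqrt_eq_one, div_eq_one_iff_eq p.ne'] at e2
    rw [hsub, e2, sub_self]
  have hsym : (Sf - S).IsSymm := by
    have a : Sfᵀ = Sf := by simpa using hSf.isHermitian.eq
    have b : Sᵀ = S := by simpa using hS.isHermitian.eq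
    simp [IsSymm, a, b]
  have := mat_eq_zero_of_squad _ hsym hq
  exact (sub_eq_zero.1 this).symm

theorem sliced_covariance_convergence
    (n : ℕ) (hn : 1 ≤ n) (T : ℝ) (hT : 0 < T)
    (Sf : Matrix (Fin n) (Fin n) ℝ) (hSf : Sf.PosDef)
    (S : ℝ → Matrix (Fin n) (Fin n) ℝ)
    (K : ℝ → Matrix (Fin n) (Fin n) ℝ)
    (hK : ∀ t ∈ Set.Ico (0 : ℝ) T, ∀ i j : Fin n,
      K t i j = (1 / (T - t)) *
        ((∫ θ : sphere (0 : EuclideanSpace ℝ (Fin n)) 1,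
            Real.sqrt (squad Sf θ / squad (S t) θ) *
              ((θ : EuclideanSpace ℝ (Fin n)) i * (θ : EuclideanSpace ℝ (Fin n)) j)
            ∂(sphereUniform n))
          - (1 / (n : ℝ)) * (if i = j then 1 else 0)))
    (hcont : ContinuousOn S (Set.Icc 0 T))
    (hpos : ∀ t ∈ Set.Icc (0 : ℝ) T, (S t).PosDef)
    (hode : ∀ t ∈ Set.Ico (0 : ℝ) T, ∀ i j : Fin n,
      HasDerivWithinAt (fun s => S s i j)
        ((K t * S t + S t * (K t)ᵀ) i j) (Set.Ico (0 : ℝ) T) t) :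
    Filter.Tendsto S (nhdsWithin T (Set.Iio T)) (nhds Sf) ∧ S T = Sf := by
  have hTmem : T ∈ Set.Icc (0 : ℝ) T := ⟨hT.le, le_rfl⟩
  let F : ℝ → Matrix (Fin n) (Fin n) ℝ := fun t => Matrix.of fun i j =>
    (∫ θ : sphere (0 : EuclideanSpace ℝ (Fin n)) 1,
            Real.sqrt (squad Sf θ / squad (S t) θ) *
              ((θ : EuclideanSpace ℝ (Fin n)) i * (θ : EuclideanSpace ℝ (Fin n)) j)
            ∂(sphereUniform n))
          - (1 / (n : ℝ)) * (if i = j then 1 else 0)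
  have hKF : ∀ t ∈ Set.Ico (0 : ℝ) T, K t = (1 / (T - t)) • F t := by
    intro t ht
    ext i j
    rw [hK t ht]; simp [F]
  have hScont : ∀ i j, ContinuousOn (fun t => S t i j) (Set.Icc 0 T) := by
    intro i j
    exact (continuous_apply_apply i j).comp_continuousOn hcont
  have hFcont : ∀ i j, ContinuousOn (fun t => F t i j) (Set.Icc 0 T) := by
    intro i j
    simp only [F, Matrix.of_apply]
    refine ContinuousOn.sub ?_ continuousOn_const
    rw [continuousOn_iff_continuous_domRestrict]
    have hq : Continuous (fun p : Set.Icc (0 : ℝ) T × sphere (0 : EuclideanSpace ℝ (Fin n)) 1 =>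
        squad (S p.1) p.2) := by
      unfold squad
      refine continuous_finsetSum _ fun k _ => continuous_finsetSum _ fun l _ => ?_
      have h1 : Continuous (fun p : Set.Icc (0 : ℝ) T ×
          sphere (0 : EuclideanSpace ℝ (Fin n)) 1 => S p.1 k l) :=
        (continuousOn_iff_continuous_domRestrict.1 (hScont k l)).comp continuous_fst
      exact (((coord_cont k).comp continuous_snd).mul h1).mul ((coord_cont l).comp continuous_snd)
    have hu : Continuous (Function.uncurry fun (t : Set.Icc (0 : ℝ) T)
        (θ : sphere (0 : EuclideanSpace ℝ (Fin n)) 1) =>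
          Real.sqrt (squad Sf θ / squad (S t) θ) *
              ((θ : EuclideanSpace ℝ (Fin n)) i * (θ : EuclideanSpace ℝ (Fin n)) j)) := by
      refine Continuous.mul (Real.continuous_sqrt.comp
        (((squad_cont Sf).comp continuous_snd).div hq ?_))
        (((coord_cont i).comp continuous_snd).mul ((coord_cont j).comp continuous_snd))
      rintro ⟨t, θ⟩
      exact (squad_pos _ (hpos t t.2) θ).ne'
    have := continuous_parametric_integral_of_continuous (μ := sphereUniform n) hu isCompact_univ
    simp only [setIntegral_univ] at this
    exact this
  let G : ℝ → Matrix (Fin n) (Fin n) ℝ := fun t => F t * S t + S t * (F t)ᵀ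
  have hGcont : ∀ i j, ContinuousOn (fun t => G t i j) (Set.Icc 0 T) := by
    intro i j
    simp only [G, Matrix.add_apply, Matrix.mul_apply, Matrix.transpose_apply]
    refine ContinuousOn.add ?_ ?_
    · exact continuousOn_finsetSum _ fun k _ => (hFcont i k).mul (hScont k j)
    · exact continuousOn_finsetSum _ fun k _ => (hScont i k).mul (hFcont j k)
  have hGd : ∀ i j, ∀ t ∈ Set.Ico (0 : ℝ) T, HasDerivWithinAt (fun s => S s i j)
      (1 / (T - t) * G t i j) (Set.Ico 0 T) t := by
    intro i j t ht
    have := hode t ht i j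
    rw [hKF t ht] at this
    convert this using 1
    simp [G, mul_add]
  have hG0 : G T = 0 := by
    ext i j
    refine le_antisymm (log_blowup T hT _ (fun t => G t i j) (hScont i j)
      (hGcont i j T hTmem) (hGd i j)) ?_
    have := log_blowup T hT (fun t => - S t i j) (fun t => - G t i j) (hScont i j).neg
      (hGcont i j T hTmem).neg (fun t ht => by
        have := (hGd i j t ht).neg
        rw [mul_neg]
        exact this)
    simp only [Matrix.zero_apply]
    linarith
  have hFsym : (F T)ᵀ = F T := by
    ext i j
    simp only [F, Matrix.transpose_apply, Matrix.of_apply, eq_comm (a := i) (b := j)]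
    congr 1
    refine integral_congr_ae (Filter.Eventually.of_forall fun θ => ?_)
    simp only
    ring
  have hF0 : F T = 0 := lyap _ _ (hpos T hTmem) hFsym hG0
  have hST : S T = Sf := by
    refine final_step hn _ _ (hpos T hTmem) hSf fun i j => ?_
    have := congrFun (congrFun hF0 i) j
    simp only [F, Matrix.of_apply, Matrix.zero_apply] at this
    linarith
  refine ⟨?_, hST⟩
  have h1 : Filter.Tendsto S (nhdsWithin T (Set.Icc 0 T)) (nhds Sf) := by
    have := hcont T hTmem
    rwa [ContinuousWithinAt, hST] at this
  have h2 : Filter.Tendsto S (nhdsWithin T (Set.Ico 0 T)) (nhds Sf) :=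
    h1.mono_left (nhdsWithin_mono _ Set.Ico_subset_Icc_self)
  rwa [nhdsWithin_Ico_eq_nhdsLT hT] at h2
end

section
/- Let n ≥ 1 and let I ⊆ ℝ be an open interval. Let K : I → (n×n real matrices) and η : I → ℝⁿ be continuous, and let m : I → ℝⁿ and Σ : I → (n×n real symmetric positive definite matrices) be differentiable with m′(t) = K(t) m(t) + η(t) and Σ′(t) = K(t) Σ(t) + Σ(t) K(t)ᵀ for all t ∈ I. Define the Gaussian density ρ(t, x) := (2π)^{−n/2} (det Σ(t))^{−1/2} exp( −(1/2) (x − m(t))ᵀ Σ(t)^{−1} (x − m(t)) ) and the affine velocity field v(t, x) := K(t) x + η(t). Then ρ solves the continuity equation classically: for every t ∈ I and x ∈ ℝⁿ, ∂_t ρ(t, x) + ∑_{i=1}^n ∂_{x_i} ( ρ(t, x) v_i(t, x) ) = 0. -/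
open Matrix Real

theorem aux_det {n : ℕ} (S : ℝ → Matrix (Fin n) (Fin n) ℝ) (S' : Matrix (Fin n) (Fin n) ℝ) (t : ℝ)
    (hS : ∀ i j, HasDerivAt (fun s => S s i j) (S' i j) t) :
    HasDerivAt (fun s => (S s).det) ((S t).adjugate * S').trace t := by
  have h1 : HasDerivAt (fun s => (S s).det)
      (∑ σ : Equiv.Perm (Fin n), ((Equiv.Perm.sign σ : ℤ) : ℝ) *
        ∑ i, (∏ j ∈ Finset.univ.erase i, S t (σ j) j) • S' (σ i) i) t := by
    simp only [det_apply']
    refine HasDerivAt.fun_sum fun σ _ => HasDerivAt.const_mul _ ?_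
    exact HasDerivAt.fun_finsetProd fun i _ => hS (σ i) i
  convert h1 using 1
  have h2 : ((S t).adjugate * S').trace = ∑ i, ((S t).updateCol i (fun k => S' k i)).det := by
    simp only [trace, diag, ← cramer_apply, cramer_eq_adjugate_mulVec]
    rfl
  rw [h2]
  simp only [det_apply', Finset.mul_sum]
  rw [Finset.sum_comm]
  refine Finset.sum_congr rfl fun σ _ => Finset.sum_congr rfl fun i _ => ?_
  rw [← Finset.mul_prod_erase _ _ (Finset.mem_univ i)]
  have : ∏ j ∈ Finset.univ.erase i, (S t).updateCol i (fun k => S' k i) (σ j) j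
      = ∏ j ∈ Finset.univ.erase i, S t (σ j) j :=
    Finset.prod_congr rfl fun j hj => by rw [updateCol_ne (Finset.ne_of_mem_erase hj)]
  rw [this]
  simp [mul_comm]

theorem aux_inv {n : ℕ} (S : ℝ → Matrix (Fin n) (Fin n) ℝ) (S' : Matrix (Fin n) (Fin n) ℝ) (t : ℝ)
    (hS : ∀ i j, HasDerivAt (fun s => S s i j) (S' i j) t) (hdet : (S t).det ≠ 0) (i j : Fin n) :
    HasDerivAt (fun s => (S s)⁻¹ i j) ((-((S t)⁻¹ * S' * (S t)⁻¹)) i j) t := by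
  let _ := Matrix.linftyOpNormedRing (n := Fin n) (α := ℝ)
  let _ := Matrix.linftyOpNormedAlgebra (n := Fin n) (R := ℝ) (α := ℝ)
  have hd : HasDerivAt S S' t := hasDerivAt_pi.2 fun i => hasDerivAt_pi.2 fun j => hS i j
  obtain ⟨u, hu⟩ := (Matrix.isUnit_iff_isUnit_det (S t)).2 (isUnit_iff_ne_zero.2 hdet)
  have h := hasFDerivAt_ringInverse (𝕜 := ℝ) u
  rw [hu] at h
  have h3 := h.comp_hasDerivAt t hd
  have h4 := hasDerivAt_pi.1 (hasDerivAt_pi.1 h3 i) j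
  have h5 : ((u⁻¹ : (Matrix (Fin n) (Fin n) ℝ)ˣ) : Matrix (Fin n) (Fin n) ℝ) = (S t)⁻¹ := by
    rw [← hu, Matrix.coe_units_inv]
  have e1 : (fun s => (S s)⁻¹ i j) = fun x => (Ring.inverse ∘ S) x i j := by
    funext s
    simp [nonsing_inv_eq_ringInverse]
  have e2 : (-((S t)⁻¹ * S' * (S t)⁻¹)) i j =
      (-((ContinuousLinearMap.mulLeftRight ℝ (Matrix (Fin n) (Fin n) ℝ))
        (u⁻¹ : (Matrix (Fin n) (Fin n) ℝ)ˣ)) (u⁻¹ : (Matrix (Fin n) (Fin n) ℝ)ˣ)) S' i j := by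
    rw [h5]
    simp
  rw [e1, e2]
  exact h4

theorem aux_quad {n : ℕ} (P : ℝ → Matrix (Fin n) (Fin n) ℝ) (P' : Matrix (Fin n) (Fin n) ℝ)
    (u : ℝ → Fin n → ℝ) (u' : Fin n → ℝ) (t : ℝ)
    (hP : ∀ i j, HasDerivAt (fun s => P s i j) (P' i j) t) (hsym : (P t)ᵀ = P t)
    (hu : HasDerivAt u u' t) :
    HasDerivAt (fun s => u s ⬝ᵥ P s *ᵥ u s)
      (2 * (u' ⬝ᵥ P t *ᵥ u t) + u t ⬝ᵥ P' *ᵥ u t) t := by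
  have hu' := hasDerivAt_pi.1 hu
  have h : HasDerivAt (fun s => u s ⬝ᵥ P s *ᵥ u s)
      (∑ i, (u' i * ∑ j, P t i j * u t j + u t i * ∑ j, (P' i j * u t j + P t i j * u' j))) t := by
    simp only [dotProduct, mulVec]
    exact HasDerivAt.fun_sum fun i _ => (hu' i).mul
      (HasDerivAt.fun_sum fun j _ => (hP i j).mul (hu' j))
  convert h using 1
  have e : u t ⬝ᵥ P t *ᵥ u' = u' ⬝ᵥ P t *ᵥ u t := by
    rw [dotProduct_mulVec, ← mulVec_transpose, hsym, dotProduct_comm]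
  have : (∑ i, (u' i * ∑ j, P t i j * u t j + u t i * ∑ j, (P' i j * u t j + P t i j * u' j)))
      = u' ⬝ᵥ P t *ᵥ u t + (u t ⬝ᵥ P' *ᵥ u t + u t ⬝ᵥ P t *ᵥ u') := by
    simp only [dotProduct, mulVec, Finset.sum_add_distrib, mul_add]
  rw [this, e]; ring

/-- Gaussianity is preserved by an affine velocity field: if `m′ = K m + η` and
`Σ′ = K Σ + Σ Kᵀ` on an open interval, with `Σ(t)` symmetric positive definite, then
the Gaussian density `ρ(t,x) = (2π)^{-n/2} (det Σ(t))^{-1/2} exp(−½ (x−m(t))ᵀ Σ(t)⁻¹ (x−m(t)))`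
solves the continuity equation `∂_t ρ + ∑ᵢ ∂_{xᵢ}(ρ vᵢ) = 0` classically, where
`v(t,x) = K(t)x + η(t)`. -/
theorem gaussian_continuity_equation
    (n : ℕ) (hn : 1 ≤ n) (a b : ℝ)
    (K : ℝ → Matrix (Fin n) (Fin n) ℝ) (η : ℝ → Fin n → ℝ)
    (hKcont : ContinuousOn K (Set.Ioo a b)) (hηcont : ContinuousOn η (Set.Ioo a b))
    (m : ℝ → Fin n → ℝ) (S : ℝ → Matrix (Fin n) (Fin n) ℝ)
    (hpos : ∀ t ∈ Set.Ioo a b, (S t).PosDef)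
    (hm : ∀ t ∈ Set.Ioo a b, HasDerivAt m ((K t).mulVec (m t) + η t) t)
    (hS : ∀ t ∈ Set.Ioo a b, ∀ i j : Fin n,
      HasDerivAt (fun s => S s i j) ((K t * S t + S t * (K t)ᵀ) i j) t)
    (ρ : ℝ → (Fin n → ℝ) → ℝ)
    (hρ : ∀ t x, ρ t x =
      (2 * π) ^ (-(n : ℝ) / 2) * (S t).det ^ (-(1 : ℝ) / 2) *
        Real.exp (-(1 / 2) * ((x - m t) ⬝ᵥ (S t)⁻¹.mulVec (x - m t))))
    (v : ℝ → (Fin n → ℝ) → Fin n → ℝ)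
    (hv : ∀ t x, v t x = (K t).mulVec x + η t) :
    ∀ t ∈ Set.Ioo a b, ∀ x : Fin n → ℝ,
      deriv (fun s => ρ s x) t +
        ∑ i, fderiv ℝ (fun y => ρ t y * v t y i) x (Pi.single i 1) = 0 := by
  intro t ht x
  have hp := hpos t ht
  have hdet : 0 < (S t).det := hp.det_pos
  have hunit : IsUnit (S t).det := isUnit_iff_ne_zero.2 hdet.ne'
  have hsymS : (S t)ᵀ = S t := by simpa using hp.isHermitian.eq
  have hsym : ((S t)⁻¹)ᵀ = (S t)⁻¹ := by rw [transpose_nonsing_inv, hsymS]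
  have hSP : S t * (S t)⁻¹ = 1 := mul_nonsing_inv _ hunit
  have hPS : (S t)⁻¹ * S t = 1 := nonsing_inv_mul _ hunit
  set P := (S t)⁻¹ with hPdef
  set w := P *ᵥ (x - m t) with hw
  -- time derivative
  have hD := aux_det S _ t (hS t ht)
  have hP := aux_inv S _ t (hS t ht) hdet.ne'
  have hu : HasDerivAt (fun s => x - m s) (-((K t).mulVec (m t) + η t)) t :=
    (hm t ht).const_sub x
  have hq := aux_quad (fun s => (S s)⁻¹) _ _ _ t hP hsym hu
  have hP' : -(P * (K t * S t + S t * (K t)ᵀ) * P) = -(P * K t + (K t)ᵀ * P) := by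
    congr 1
    rw [mul_add, add_mul, Matrix.mul_assoc P (K t * S t), Matrix.mul_assoc (K t), hSP,
      Matrix.mul_one, ← Matrix.mul_assoc P (S t), hPS, Matrix.one_mul]
  have hq' : 2 * (-((K t).mulVec (m t) + η t) ⬝ᵥ (S t)⁻¹ *ᵥ (x - m t)) +
      (x - m t) ⬝ᵥ (-((S t)⁻¹ * (K t * S t + S t * (K t)ᵀ) * (S t)⁻¹)) *ᵥ (x - m t)
      = -2 * (w ⬝ᵥ v t x) := by
    rw [← hPdef, hP', hv, ← hw]
    have e1 : (x - m t) ⬝ᵥ (P * K t) *ᵥ (x - m t) = w ⬝ᵥ K t *ᵥ (x - m t) := by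
      rw [← mulVec_mulVec, dotProduct_mulVec, ← mulVec_transpose, hsym]
    have e2 : (x - m t) ⬝ᵥ ((K t)ᵀ * P) *ᵥ (x - m t) = w ⬝ᵥ K t *ᵥ (x - m t) := by
      rw [← mulVec_mulVec, dotProduct_mulVec, ← mulVec_transpose, transpose_transpose,
        dotProduct_comm]
    rw [neg_mulVec, add_mulVec, dotProduct_neg, dotProduct_add, e1, e2, neg_dotProduct,
      dotProduct_comm _ w, mulVec_sub, dotProduct_sub, dotProduct_add, dotProduct_add]
    ring
  have htr : ((S t).adjugate * (K t * S t + S t * (K t)ᵀ)).trace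
      = 2 * (S t).det * (K t).trace := by
    rw [mul_add, trace_add, ← Matrix.mul_assoc, trace_mul_comm, ← Matrix.mul_assoc,
      ← Matrix.mul_assoc, mul_adjugate, adjugate_mul]
    simp
    ring
  rw [htr] at hD
  have hq2 : HasDerivAt (fun s => (x - m s) ⬝ᵥ (S s)⁻¹ *ᵥ (x - m s)) (-2 * (w ⬝ᵥ v t x)) t := by
    rw [← hq']; exact hq
  have hpow : HasDerivAt (fun s => (S s).det ^ (-(1 : ℝ) / 2))
      (-(K t).trace * (S t).det ^ (-(1 : ℝ) / 2)) t := by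
    convert hD.rpow_const (p := -(1 : ℝ) / 2) (Or.inl hdet.ne') using 1
    rw [Real.rpow_sub_one hdet.ne']
    field_simp
  have hT : HasDerivAt (fun s => ρ s x) (ρ t x * (w ⬝ᵥ v t x - (K t).trace)) t := by
    simp only [hρ]
    refine ((hpow.const_mul ((2 * π) ^ (-(n : ℝ) / 2))).mul
      ((hq2.const_mul (-(1 / 2))).exp)).congr_deriv ?_
    simp only [← hPdef]
    ring
  -- space derivatives
  have hX : ∀ i, fderiv ℝ (fun y => ρ t y * v t y i) x (Pi.single i 1)
      = ρ t x * (K t i i - w i * v t x i) := by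
    intro i
    have hdiff : DifferentiableAt ℝ (fun y => ρ t y * v t y i) x := by
      simp only [hρ, hv, dotProduct, mulVec, Pi.add_apply, Pi.sub_apply]
      fun_prop
    have hline : HasDerivAt (fun r : ℝ => x + r • (Pi.single i 1 : Fin n → ℝ))
        (Pi.single i 1) 0 := by
      simpa using ((hasDerivAt_id (0 : ℝ)).smul_const (Pi.single i 1 : Fin n → ℝ)).const_add x
    have hd2 : HasFDerivAt (fun y => ρ t y * v t y i)
        (fderiv ℝ (fun y => ρ t y * v t y i) x) (x + (0 : ℝ) • (Pi.single i 1 : Fin n → ℝ)) := by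
      simpa using hdiff.hasFDerivAt
    have hA := hd2.comp_hasDerivAt (0 : ℝ) hline
    have hQ := aux_quad (fun _ => P) 0 (fun r : ℝ => x + r • (Pi.single i 1 : Fin n → ℝ) - m t)
      (Pi.single i 1) 0 (fun i j => by simpa using hasDerivAt_const (0 : ℝ) (P i j)) hsym
      (hline.sub_const (m t))
    have hV : HasDerivAt (fun r : ℝ => v t (x + r • (Pi.single i 1 : Fin n → ℝ)) i) (K t i i) 0 := by
      simp only [hv, mulVec_add, mulVec_smul, Pi.add_apply, Pi.smul_apply, smul_eq_mul]
      simpa using (((hasDerivAt_id (0 : ℝ)).mul_const (K t i i)).const_add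
        ((K t *ᵥ x) i)).add_const (η t i)
    have hR : HasDerivAt (fun r : ℝ => ρ t (x + r • (Pi.single i 1 : Fin n → ℝ)))
        (- ρ t x * w i) 0 := by
      simp only [hρ]
      refine (((hQ.const_mul (-(1 / 2))).exp).const_mul
        ((2 * π) ^ (-(n : ℝ) / 2) * (S t).det ^ (-(1 : ℝ) / 2))).congr_deriv ?_
      simp [← hPdef, ← hw]
      ring
    have hB := hR.mul hV
    have := hA.unique hB
    rw [this]
    simp
    ring
  rw [hT.deriv, Finset.sum_congr rfl fun i _ => hX i, ← Finset.mul_sum, Finset.sum_sub_distrib]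
  simp only [trace, diag, dotProduct]
  ring
end
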